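/- Let d ≥ 2 be an even integer and let a, e be indeterminates. Let n be a positive integer with n ≡ d+1 (mod 2d). Then Σ_{k=0}^{(dn+n−1)/(2d)} [3dk+1]_q · (q,e,q^{1+d}/e; q^{2d})_k (aq,q/a,q^{d−1}; q^d)_k / ((q^d,e,q^{1+d}/e; q^d)_k (aq^{2d},q^{2d}/a,q^{d+2}; q^{2d})_k) · q^{dk} ≡ 0 modulo Φ_n(q)(1−aq^n)(a−q^n), as a congruence of rational functions in q, a and e. -/

import Mathlib

open Finset

noncomputable section

abbrev R3 : Type := MvPolynomial (Fin 3) ℚ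
abbrev K3 : Type := FractionRing R3

/-- The variable `q` as a rational function in `ℚ(q,a,e)`. -/
def qv : K3 := algebraMap R3 K3 (MvPolynomial.X 0)

/-- The indeterminate `a` as a rational function in `ℚ(q,a,e)`. -/
def av : K3 := algebraMap R3 K3 (MvPolynomial.X 1)

/-- The indeterminate `e` as a rational function in `ℚ(q,a,e)`. -/
def ev : K3 := algebraMap R3 K3 (MvPolynomial.X 2)

/-- The q-shifted factorial `(a; q)_k = (1-a)(1-aq)⋯(1-aq^{k-1})`. -/
def qPoch {R : Type*} [CommRing R] (a q : R) (k : ℕ) : R :=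
  ∏ j ∈ Finset.range k, (1 - a * q ^ j)

/-- The q-integer `[m]_q = (1 - q^m)/(1 - q)`. -/
def qInt {K : Type*} [Field K] (q : K) (m : ℤ) : K := (1 - q ^ m) / (1 - q)

/-- The n-th cyclotomic polynomial `Φ_n(q)` viewed inside `ℚ[q,a,e]`. -/
def Phi3 (n : ℕ) : R3 := Polynomial.aeval (MvPolynomial.X 0) (Polynomial.cyclotomic n ℚ)

/-- `A ≡ B (mod M)`: the polynomial `M` divides the numerator of the reduced form
of the rational function `A - B`. -/
def CongrMod3 (A B : K3) (M : R3) : Prop :=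
  ∃ f g : R3, g ≠ 0 ∧ (∀ p : R3, Prime p → p ∣ g → ¬ p ∣ M) ∧
    (A - B) * algebraMap R3 K3 g = algebraMap R3 K3 M * algebraMap R3 K3 f

/-! ### q-shifted factorials -/

theorem qPoch_zero {R : Type*} [CommRing R] (a q : R) : qPoch a q 0 = 1 := by
  simp [qPoch]

theorem qPoch_succ {R : Type*} [CommRing R] (a q : R) (k : ℕ) :
    qPoch a q (k + 1) = qPoch a q k * (1 - a * q ^ k) :=
  prod_range_succ _ _

theorem qPoch_succ' {R : Type*} [CommRing R] (a q : R) (k : ℕ) :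
    qPoch a q (k + 1) = (1 - a) * qPoch (a * q) q k := by
  simp only [qPoch, prod_range_succ', pow_zero, mul_one]
  rw [mul_comm]
  congr 1
  exact prod_congr rfl fun j _ => by ring

theorem qPoch_eq_zero {R : Type*} [CommRing R] {a q : R} {j k : ℕ} (hjk : j < k)
    (h : a * q ^ j = 1) : qPoch a q k = 0 :=
  prod_eq_zero (mem_range.2 hjk) (by rw [h, sub_self])

/-- The denominator of the `k`-th term of the quadratic series `quadTerm`. -/
def quadDen {F : Type*} [Field F] (Q d₁ d₂ b c f : F) (k : ℕ) : F :=
  qPoch Q Q k * qPoch d₁ Q k * qPoch d₂ Q k *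
    (qPoch (c * f * Q) (Q ^ 2) k * qPoch (b * f * Q) (Q ^ 2) k * qPoch (b * c * Q) (Q ^ 2) k)

/-- The summand of the quadratic basic hypergeometric series, whose parameters are meant to satisfy
`A Q = d₁ d₂ = b c f`. -/
def quadTerm {F : Type*} [Field F] (Q A d₁ d₂ b c f : F) (k : ℕ) : F :=
  (1 - A * Q ^ (3 * k)) * (qPoch A (Q ^ 2) k * qPoch d₁ (Q ^ 2) k * qPoch d₂ (Q ^ 2) k) *
      (qPoch b Q k * qPoch c Q k * qPoch f Q k) * Q ^ k /
    quadDen Q d₁ d₂ b c f k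

/-- The telescoping part of `quadTerm`, at index `k + 1`. -/
def quadBdry {F : Type*} [Field F] (Q A d₁ d₂ b c f : F) (k : ℕ) : F :=
  qPoch A (Q ^ 2) (k + 2) * (1 - c * Q ^ (2 * k + 1)) *
      (qPoch (b * Q) Q (k + 1) * qPoch (f * Q) Q (k + 1) * qPoch c Q k) *
      (qPoch d₁ (Q ^ 2) (k + 1) * qPoch d₂ (Q ^ 2) (k + 1)) / quadDen Q d₁ d₂ b c f (k + 1)

/-- The factor relating the series to the one with shifted parameters. -/
def quadFactor {F : Type*} [Field F] (Q A d₁ d₂ b c f : F) : F :=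
  (Q * (d₁ + d₂) - c - Q ^ 2 * b * f) *
      ((1 - A) * (1 - A * Q ^ 2) * (1 - b * Q) * (1 - f * Q)) /
    ((1 - d₁ * Q) * (1 - d₂ * Q) * ((1 - c * f * Q) * (1 - b * c * Q)) *
      ((1 - b * f * Q) * (1 - b * f * Q ^ 3)))

theorem quadDen_succ {F : Type*} [Field F] (Q d₁ d₂ b c f : F) (k : ℕ) :
    quadDen Q d₁ d₂ b c f (k + 1) = quadDen Q d₁ d₂ b c f k *
      ((1 - Q ^ (k + 1)) * ((1 - d₁ * Q ^ k) * (1 - d₂ * Q ^ k)) *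
        ((1 - c * f * Q ^ (2 * k + 1)) * (1 - b * f * Q ^ (2 * k + 1)) *
          (1 - b * c * Q ^ (2 * k + 1)))) := by
  simp only [quadDen, qPoch_succ]
  ring

theorem quadDen_add_two {F : Type*} [Field F] (Q d₁ d₂ b c f : F) (k : ℕ) :
    quadDen Q d₁ d₂ b c f (k + 2) =
      ((1 - d₁ * Q) * (1 - d₂ * Q) * ((1 - c * f * Q) * (1 - b * c * Q)) *
        ((1 - b * f * Q) * (1 - b * f * Q ^ 3)) *
      quadDen Q (d₁ * Q ^ 2) (d₂ * Q ^ 2) (b * Q ^ 2) c (f * Q ^ 2) k) *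
      ((1 - d₁) * (1 - d₂) * ((1 - Q * Q ^ k) * (1 - Q ^ 2 * Q ^ k)) *
        ((1 - c * f * Q ^ 3 * (Q ^ k) ^ 2) * (1 - b * c * Q ^ 3 * (Q ^ k) ^ 2))) := by
  have h1 (x : F) : qPoch x Q (k + 2) = (1 - x) * (1 - x * Q) * qPoch (x * Q ^ 2) Q k := by
    rw [qPoch_succ', qPoch_succ', mul_assoc x, ← sq, mul_assoc]
  have h2 (x : F) : qPoch x (Q ^ 2) (k + 2) =
      (1 - x) * qPoch (x * Q ^ 2) (Q ^ 2) k * (1 - x * Q ^ (2 * k + 2)) := by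
    rw [qPoch_succ', qPoch_succ]
    ring
  have h3 : qPoch (b * f * Q) (Q ^ 2) (k + 2) =
      (1 - b * f * Q) * (1 - b * f * Q ^ 3) *
        qPoch (b * Q ^ 2 * (f * Q ^ 2) * Q) (Q ^ 2) k := by
    rw [qPoch_succ', qPoch_succ',
      show b * f * Q * Q ^ 2 * Q ^ 2 = b * Q ^ 2 * (f * Q ^ 2) * Q by ring]
    ring
  have h4 : qPoch Q Q (k + 2) = qPoch Q Q k * ((1 - Q ^ (k + 1)) * (1 - Q ^ (k + 2))) := by
    rw [qPoch_succ, qPoch_succ]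
    ring
  simp only [quadDen]
  rw [h1 d₁, h1 d₂, h2 (c * f * Q), h2 (b * c * Q), h3, h4,
    show c * (f * Q ^ 2) * Q = c * f * Q * Q ^ 2 by ring,
    show b * Q ^ 2 * c * Q = b * c * Q * Q ^ 2 by ring]
  ring

theorem quadTerm_add_two {F : Type*} [Field F] {Q A d₁ d₂ b c f : F}
    (hA : A * Q = b * c * f) (hd : d₁ * d₂ = b * c * f) (k : ℕ)
    (h : quadDen Q d₁ d₂ b c f (k + 2) ≠ 0) :
    quadTerm Q A d₁ d₂ b c f (k + 2) =
      quadBdry Q A d₁ d₂ b c f (k + 1) - quadBdry Q A d₁ d₂ b c f k -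
        quadFactor Q A d₁ d₂ b c f *
          quadTerm Q (A * Q ^ 4) (d₁ * Q ^ 2) (d₂ * Q ^ 2) (b * Q ^ 2) c (f * Q ^ 2) k := by
  set z := Q ^ k with hz
  set W := qPoch A (Q ^ 2) (k + 2) *
      (qPoch (b * Q) Q (k + 1) * qPoch (f * Q) Q (k + 1) * qPoch c Q k) *
      (qPoch d₁ (Q ^ 2) (k + 1) * qPoch d₂ (Q ^ 2) (k + 1)) / quadDen Q d₁ d₂ b c f (k + 2)
    with hW
  have e1 : quadTerm Q A d₁ d₂ b c f (k + 2) = W * ((1 - A * Q ^ 6 * z ^ 3) * (Q ^ 2 * z) *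
      ((1 - b) * (1 - f) * ((1 - c * z) * (1 - c * Q * z))) *
      ((1 - d₁ * Q ^ 2 * z ^ 2) * (1 - d₂ * Q ^ 2 * z ^ 2))) := by
    rw [quadTerm, hW, qPoch_succ' b, qPoch_succ' f, qPoch_succ c, qPoch_succ c,
      qPoch_succ d₁, qPoch_succ d₂, hz]
    ring
  have e2 : quadBdry Q A d₁ d₂ b c f (k + 1) = W * ((1 - A * Q ^ 4 * z ^ 2) *
      (1 - c * Q ^ 3 * z ^ 2) * ((1 - b * Q ^ 2 * z) * (1 - f * Q ^ 2 * z) * (1 - c * z)) *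
      ((1 - d₁ * Q ^ 2 * z ^ 2) * (1 - d₂ * Q ^ 2 * z ^ 2))) := by
    rw [quadBdry, hW, qPoch_succ A _ (k + 2), qPoch_succ (b * Q) _ (k + 1),
      qPoch_succ (f * Q) _ (k + 1), qPoch_succ c,
      qPoch_succ d₁ _ (k + 1), qPoch_succ d₂ _ (k + 1), hz]
    ring
  have e3 : quadBdry Q A d₁ d₂ b c f k = W * ((1 - c * Q * z ^ 2) * ((1 - Q ^ 2 * z) *
      ((1 - d₁ * Q * z) * (1 - d₂ * Q * z)) * ((1 - c * f * Q ^ 3 * z ^ 2) *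
        (1 - b * f * Q ^ 3 * z ^ 2) * (1 - b * c * Q ^ 3 * z ^ 2)))) := by
    have hs := quadDen_succ Q d₁ d₂ b c f (k + 1)
    rw [hs] at h
    have h' := mul_ne_zero_iff.1 h
    rw [quadBdry, hW, hs, div_mul_eq_mul_div, div_eq_div_iff h'.1 h, hz]
    ring
  have e4 : quadFactor Q A d₁ d₂ b c f *
      quadTerm Q (A * Q ^ 4) (d₁ * Q ^ 2) (d₂ * Q ^ 2) (b * Q ^ 2) c (f * Q ^ 2) k =
      W * ((Q * (d₁ + d₂) - c - Q ^ 2 * b * f) * z * (1 - A * Q ^ 4 * z ^ 3) *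
        ((1 - Q * z) * (1 - Q ^ 2 * z)) *
        ((1 - c * f * Q ^ 3 * z ^ 2) * (1 - b * c * Q ^ 3 * z ^ 2))) := by
    have hs := quadDen_add_two Q d₁ d₂ b c f k
    rw [hs] at h
    rw [quadTerm, quadFactor, hW, hs, qPoch_succ' A, qPoch_succ' (A * Q ^ 2),
      qPoch_succ' (b * Q), qPoch_succ' (f * Q), qPoch_succ' d₁, qPoch_succ' d₂,
      div_mul_div_comm, div_mul_eq_mul_div, ← mul_div_mul_right _ _ (mul_ne_zero_iff.1 h).2,
      pow_mul' Q 3 k, ← hz, show A * Q ^ 2 * Q ^ 2 = A * Q ^ 4 by ring, mul_assoc b Q Q,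
      mul_assoc f Q Q, ← sq]
    congr 1
    generalize 1 - A * Q ^ 4 * z ^ 3 = x1, 1 - A * Q ^ 2 = x2, 1 - A = x3, 1 - d₁ = x4,
      1 - d₂ = x5, 1 - Q * z = x6, 1 - Q ^ 2 * z = x7, 1 - c * f * Q ^ 3 * z ^ 2 = x8,
      1 - b * c * Q ^ 3 * z ^ 2 = x9, 1 - b * Q = x10, 1 - f * Q = x11,
      Q * (d₁ + d₂) - c - Q ^ 2 * b * f = x12
    ring
  rw [e1, e2, e3, e4, ← mul_sub, ← mul_sub]
  congr 1
  have hd' (x : F) : (1 - d₁ * x) * (1 - d₂ * x) = 1 - (d₁ + d₂) * x + b * c * f * x ^ 2 := by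
    rw [← hd]
    ring
  have hA' (x : F) (m : ℕ) : A * Q ^ (m + 1) * x = b * c * f * Q ^ m * x := by
    rw [← hA]
    ring
  rw [hA', hA', hA', show (1 - d₁ * Q * z) * (1 - d₂ * Q * z) =
      (1 - d₁ * (Q * z)) * (1 - d₂ * (Q * z)) by ring,
    show (1 - d₁ * Q ^ 2 * z ^ 2) * (1 - d₂ * Q ^ 2 * z ^ 2) =
      (1 - d₁ * (Q ^ 2 * z ^ 2)) * (1 - d₂ * (Q ^ 2 * z ^ 2)) by ring, hd', hd']
  ring

theorem sum_quadTerm {F : Type*} [Field F] {Q A d₁ d₂ b c f : F}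
    (hA : A * Q = b * c * f) (hd : d₁ * d₂ = b * c * f) (L : ℕ)
    (h : ∀ k ≤ L + 1, quadDen Q d₁ d₂ b c f k ≠ 0) :
    ∑ k ∈ range (L + 2), quadTerm Q A d₁ d₂ b c f k =
      quadBdry Q A d₁ d₂ b c f L - quadFactor Q A d₁ d₂ b c f * ∑ k ∈ range L,
          quadTerm Q (A * Q ^ 4) (d₁ * Q ^ 2) (d₂ * Q ^ 2) (b * Q ^ 2) c (f * Q ^ 2) k := by
  induction L with
  | zero =>
    have h1 := h 1 le_rfl
    have h0 : quadDen Q d₁ d₂ b c f 1 = (1 - Q) *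
        ((1 - c * f * Q) * (1 - b * f * Q) * (1 - b * c * Q)) * ((1 - d₁) * (1 - d₂)) := by
      simp only [quadDen, qPoch_succ, qPoch_zero]
      ring
    have h00 : quadDen Q d₁ d₂ b c f 0 = 1 := by
      simp [quadDen, qPoch_zero]
    rw [h0] at h1
    rw [sum_range_succ, sum_range_one, range_zero, sum_empty, mul_zero, sub_zero, quadTerm,
      quadTerm, quadBdry, h0, h00, div_one, ← eq_sub_iff_add_eq, ← sub_div, eq_div_iff h1]
    simp only [qPoch_succ, qPoch_zero]
    linear_combination ((1 - A) * (1 - d₁) * (1 - d₂) *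
      (Q * (1 - b * Q) * (1 - c * Q) * (1 - f * Q) - Q ^ 3 * (1 - b) * (1 - c) * (1 - f))) * hA
  | succ L ih =>
    rw [sum_range_succ, ih fun k hk => h k (by omega), quadTerm_add_two hA hd L (h _ le_rfl),
      sum_range_succ]
    ring

theorem quadDen_shift_ne_zero {F : Type*} [Field F] {Q d₁ d₂ b c f : F} {k : ℕ}
    (h : quadDen Q d₁ d₂ b c f (k + 2) ≠ 0) :
    quadDen Q (d₁ * Q ^ 2) (d₂ * Q ^ 2) (b * Q ^ 2) c (f * Q ^ 2) k ≠ 0 := by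
  rw [quadDen_add_two] at h
  exact right_ne_zero_of_mul (left_ne_zero_of_mul h)

/-- The quadratic series that terminates because of `A = Q ^ (-2 N)` vanishes. -/
theorem sum_quadTerm_eq_zero_of_mul_pow_eq_one {F : Type*} [Field F] (N : ℕ) :
    ∀ {Q A d₁ d₂ b c f : F} {L : ℕ}, A * Q = b * c * f → d₁ * d₂ = b * c * f →
      A * (Q ^ 2) ^ N = 1 → N ≤ L → (∀ k ≤ L, quadDen Q d₁ d₂ b c f k ≠ 0) →
      ∑ k ∈ range (L + 1), quadTerm Q A d₁ d₂ b c f k = 0 := by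
  induction N using Nat.strong_induction_on with
  | _ N ih =>
  intro Q A d₁ d₂ b c f L hA hd hN hL h
  rcases L with _ | L
  · obtain rfl : N = 0 := by omega
    have hA1 : A = 1 := by simpa using hN
    simp [quadTerm, hA1]
  rw [sum_quadTerm hA hd L h]
  have hb : quadBdry Q A d₁ d₂ b c f L = 0 := by
    rw [quadBdry, qPoch_eq_zero (j := N) (by omega) hN]
    simp
  rw [hb, zero_sub, neg_eq_zero, mul_eq_zero]
  rcases N with _ | _ | N
  · left
    have hA1 : A = 1 := by simpa using hN
    simp [quadFactor, hA1]
  · left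
    have hA1 : A * Q ^ 2 = 1 := by simpa using hN
    simp [quadFactor, hA1]
  · right
    obtain ⟨L, rfl⟩ : ∃ L', L = L' + 1 := ⟨L - 1, by omega⟩
    refine ih N (by omega) ?_ ?_ ?_ (by omega) fun k hk =>
      quadDen_shift_ne_zero (h (k + 2) (by omega))
    · linear_combination Q ^ 4 * hA
    · linear_combination Q ^ 4 * hd
    · linear_combination hN

/-- The quadratic series that terminates because of `b = Q ^ (-(2 m + 1))` vanishes. -/
theorem sum_quadTerm_eq_zero_of_mul_odd_pow_eq_one {F : Type*} [Field F] (m : ℕ) :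
    ∀ {Q A d₁ d₂ b c f : F} {L : ℕ}, A * Q = b * c * f → d₁ * d₂ = b * c * f →
      b * Q ^ (2 * m + 1) = 1 → 2 * m + 1 ≤ L → (∀ k ≤ L, quadDen Q d₁ d₂ b c f k ≠ 0) →
      ∑ k ∈ range (L + 1), quadTerm Q A d₁ d₂ b c f k = 0 := by
  induction m with
  | zero =>
    intro Q A d₁ d₂ b c f L hA hd hm hL h
    obtain ⟨L, rfl⟩ : ∃ L', L = L' + 1 := ⟨L - 1, by omega⟩
    have hb : b * Q = 1 := by simpa using hm
    rw [sum_quadTerm hA hd L h, quadBdry, quadFactor, hb,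
      qPoch_eq_zero (a := 1) (j := 0) (by omega) (by simp)]
    simp
  | succ m ih =>
    intro Q A d₁ d₂ b c f L hA hd hm hL h
    obtain ⟨L, rfl⟩ : ∃ L', L = L' + 2 := ⟨L - 2, by omega⟩
    have hb : quadBdry Q A d₁ d₂ b c f (L + 1) = 0 := by
      rw [quadBdry, qPoch_eq_zero (a := b * Q) (j := 2 * m + 2) (by omega)
        (by linear_combination hm)]
      simp
    rw [sum_quadTerm hA hd (L + 1) h, hb, zero_sub, neg_eq_zero, mul_eq_zero]
    right
    refine ih ?_ ?_ ?_ (by omega) fun k hk => quadDen_shift_ne_zero (h (k + 2) (by omega))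
    · linear_combination Q ^ 4 * hA
    · linear_combination Q ^ 4 * hd
    · linear_combination hm

theorem quadDen_swap {F : Type*} [Field F] (Q d₁ d₂ b c f : F) (k : ℕ) :
    quadDen Q d₁ d₂ c b f k = quadDen Q d₁ d₂ b c f k := by
  rw [quadDen, quadDen, mul_comm c b]
  ring

theorem quadTerm_swap {F : Type*} [Field F] (Q A d₁ d₂ b c f : F) (k : ℕ) :
    quadTerm Q A d₁ d₂ c b f k = quadTerm Q A d₁ d₂ b c f k := by
  rw [quadTerm, quadTerm, quadDen_swap]
  ring

/-! ### Polynomial numerators and denominators -/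

/-- The homogeneous q-shifted factorial `x ^ k * (y / x; q)_k`. -/
def qPochHom {R : Type*} [CommRing R] (x y q : R) (k : ℕ) : R :=
  ∏ j ∈ Finset.range k, (x - y * q ^ j)

theorem qPochHom_eq {F : Type*} [Field F] {x : F} (hx : x ≠ 0) (y q : F) (k : ℕ) :
    qPochHom x y q k = x ^ k * qPoch (y / x) q k := by
  rw [qPochHom, qPoch, ← card_range k, ← prod_const, card_range, ← prod_mul_distrib]
  refine prod_congr rfl fun j _ => ?_
  field_simp

theorem map_qPoch {R S : Type*} [CommRing R] [CommRing S] (φ : R →+* S) (a q : R) (k : ℕ) :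
    φ (qPoch a q k) = qPoch (φ a) (φ q) k := by
  simp [qPoch, map_prod]

theorem map_qPochHom {R S : Type*} [CommRing R] [CommRing S] (φ : R →+* S) (x y q : R) (k : ℕ) :
    φ (qPochHom x y q k) = qPochHom (φ x) (φ y) (φ q) k := by
  simp [qPochHom, map_prod]

/-- A polynomial numerator of the `k`-th term of the sum. -/
def termNum {R : Type*} [CommRing R] (d : ℕ) (q a e : R) (k : ℕ) : R :=
  (1 - q ^ (3 * d * k + 1)) *
    (qPoch q (q ^ (2 * d)) k * qPoch e (q ^ (2 * d)) k * qPochHom e (q ^ (1 + d)) (q ^ (2 * d)) k) *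
    (qPoch (a * q) (q ^ d) k * qPochHom a q (q ^ d) k * qPoch (q ^ (d - 1)) (q ^ d) k) * q ^ (d * k)

/-- A polynomial denominator of the `k`-th term of the sum. -/
def termDen {R : Type*} [CommRing R] (d : ℕ) (q a e : R) (k : ℕ) : R :=
  (1 - q) * (qPoch (q ^ d) (q ^ d) k * qPoch e (q ^ d) k * qPochHom e (q ^ (1 + d)) (q ^ d) k) *
    (qPoch (a * q ^ (2 * d)) (q ^ (2 * d)) k * qPochHom a (q ^ (2 * d)) (q ^ (2 * d)) k *
      qPoch (q ^ (d + 2)) (q ^ (2 * d)) k)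

theorem map_termNum {R S : Type*} [CommRing R] [CommRing S] (φ : R →+* S) (d : ℕ) (q a e : R)
    (k : ℕ) : φ (termNum d q a e k) = termNum d (φ q) (φ a) (φ e) k := by
  simp [termNum, map_qPoch, map_qPochHom]

theorem map_termDen {R S : Type*} [CommRing R] [CommRing S] (φ : R →+* S) (d : ℕ) (q a e : R)
    (k : ℕ) : φ (termDen d q a e k) = termDen d (φ q) (φ a) (φ e) k := by
  simp [termDen, map_qPoch, map_qPochHom]

theorem termNum_div_termDen {F : Type*} [Field F] (d : ℕ) {q a e : F} (ha : a ≠ 0) (he : e ≠ 0)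
    (k : ℕ) :
    termNum d q a e k / termDen d q a e k =
      qInt q (3 * (d : ℤ) * k + 1) *
          (qPoch q (q ^ (2 * d)) k * qPoch e (q ^ (2 * d)) k *
            qPoch (q ^ (1 + d) / e) (q ^ (2 * d)) k) *
          (qPoch (a * q) (q ^ d) k * qPoch (q / a) (q ^ d) k *
            qPoch (q ^ (d - 1)) (q ^ d) k) /
          (qPoch (q ^ d) (q ^ d) k * qPoch e (q ^ d) k *
            qPoch (q ^ (1 + d) / e) (q ^ d) k *
            (qPoch (a * q ^ (2 * d)) (q ^ (2 * d)) k * qPoch (q ^ (2 * d) / a) (q ^ (2 * d)) k *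
              qPoch (q ^ (d + 2)) (q ^ (2 * d)) k)) *
          q ^ (d * k) := by
  have hz : q ^ (3 * (d : ℤ) * k + 1) = q ^ (3 * d * k + 1) := by
    exact_mod_cast zpow_natCast q (3 * d * k + 1)
  rw [qInt, hz, termNum, termDen, qPochHom_eq ha, qPochHom_eq ha, qPochHom_eq he, qPochHom_eq he,
    div_mul_eq_mul_div, div_mul_eq_mul_div, div_mul_eq_mul_div, div_mul_eq_mul_div, div_div,
    eq_comm, ← mul_div_mul_left _ _ (mul_ne_zero (pow_ne_zero k ha) (pow_ne_zero k he))]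
  congr 1 <;> ring

theorem termDen_eq {F : Type*} [Field F] {d : ℕ} (hd : 0 < d) {q a e : F} (ha : a ≠ 0)
    (he : e ≠ 0) (k : ℕ) :
    termDen d q a e k = a ^ k * e ^ k * (1 - q) *
      quadDen (q ^ d) e (q ^ (1 + d) / e) (a * q) (q / a) (q ^ (d - 1)) k := by
  obtain ⟨d, rfl⟩ : ∃ d', d = d' + 1 := ⟨d - 1, by omega⟩
  have h1 : q / a * q ^ (d + 1 - 1) * q ^ (d + 1) = q ^ (2 * (d + 1)) / a := by
    rw [Nat.add_sub_cancel]
    ring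
  have h2 : a * q * q ^ (d + 1 - 1) * q ^ (d + 1) = a * q ^ (2 * (d + 1)) := by
    rw [Nat.add_sub_cancel]
    ring
  have h3 : a * q * (q / a) * q ^ (d + 1) = q ^ (d + 1 + 2) := by
    field_simp
    ring
  rw [termDen, quadDen, h1, h2, h3, qPochHom_eq ha, qPochHom_eq he, ← pow_mul, mul_comm (d + 1) 2]
  ring

theorem termNum_div_termDen_eq_quadTerm {F : Type*} [Field F] {d : ℕ} (hd : 0 < d) {q a e : F}
    (ha : a ≠ 0) (he : e ≠ 0) (k : ℕ) :
    termNum d q a e k / termDen d q a e k =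
      quadTerm (q ^ d) q e (q ^ (1 + d) / e) (a * q) (q / a) (q ^ (d - 1)) k / (1 - q) := by
  rw [termDen_eq hd ha he, termNum, quadTerm, qPochHom_eq ha, qPochHom_eq he, div_div,
    ← mul_div_mul_left _ (quadDen _ _ _ _ _ _ _ * _)
      (mul_ne_zero (pow_ne_zero k ha) (pow_ne_zero k he)), ← pow_mul q d 2, mul_comm d 2,
    ← pow_mul q d (3 * k), ← pow_mul q d k]
  congr 1 <;> ring

theorem quadDen_ne_zero_of_termDen_ne_zero {F : Type*} [Field F] {d : ℕ} (hd : 0 < d) {q a e : F}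
    (ha : a ≠ 0) (he : e ≠ 0) {k : ℕ} (h : termDen d q a e k ≠ 0) :
    quadDen (q ^ d) e (q ^ (1 + d) / e) (a * q) (q / a) (q ^ (d - 1)) k ≠ 0 := by
  rw [termDen_eq hd ha he] at h
  exact right_ne_zero_of_mul h

theorem quad_params {F : Type*} [Field F] {d : ℕ} (hd : 0 < d) {q a e : F} (ha : a ≠ 0)
    (he : e ≠ 0) :
    q * q ^ d = a * q * (q / a) * q ^ (d - 1) ∧
      e * (q ^ (1 + d) / e) = a * q * (q / a) * q ^ (d - 1) := by
  obtain ⟨d, rfl⟩ : ∃ d', d = d' + 1 := ⟨d - 1, by omega⟩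
  rw [Nat.add_sub_cancel]
  constructor <;> field_simp <;> ring

theorem sum_term_eq_zero_of_pow_eq_one {F : Type*} [Field F] {d N : ℕ} (hd : 0 < d) {q a e : F}
    (ha : a ≠ 0) (he : e ≠ 0) (hD : ∀ k ≤ N, termDen d q a e k ≠ 0)
    (h : q ^ (2 * d * N + 1) = 1) :
    ∑ k ∈ range (N + 1), termNum d q a e k / termDen d q a e k = 0 := by
  simp only [termNum_div_termDen_eq_quadTerm hd ha he]
  rw [← sum_div, sum_quadTerm_eq_zero_of_mul_pow_eq_one N (quad_params hd ha he).1
    (quad_params hd ha he).2 _ le_rfl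
    fun k hk => quadDen_ne_zero_of_termDen_ne_zero hd ha he (hD k hk), zero_div]
  rw [← h]
  ring

theorem sum_term_eq_zero_of_mul_pow_eq_one {F : Type*} [Field F] {d m N : ℕ} (hd : 0 < d)
    {q a e : F} (ha : a ≠ 0) (he : e ≠ 0) (hD : ∀ k ≤ N, termDen d q a e k ≠ 0)
    (hN : 2 * m + 1 ≤ N) (h : a * q ^ (2 * d * m + d + 1) = 1) :
    ∑ k ∈ range (N + 1), termNum d q a e k / termDen d q a e k = 0 := by
  simp only [termNum_div_termDen_eq_quadTerm hd ha he]
  rw [← sum_div, sum_quadTerm_eq_zero_of_mul_odd_pow_eq_one m (quad_params hd ha he).1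
    (quad_params hd ha he).2 _ hN
    fun k hk => quadDen_ne_zero_of_termDen_ne_zero hd ha he (hD k hk), zero_div]
  rw [← h]
  ring

theorem sum_term_eq_zero_of_eq_pow {F : Type*} [Field F] {d m N : ℕ} (hd : 0 < d)
    {q a e : F} (ha : a ≠ 0) (he : e ≠ 0) (hD : ∀ k ≤ N, termDen d q a e k ≠ 0)
    (hN : 2 * m + 1 ≤ N) (h : a = q ^ (2 * d * m + d + 1)) :
    ∑ k ∈ range (N + 1), termNum d q a e k / termDen d q a e k = 0 := by
  simp only [termNum_div_termDen_eq_quadTerm hd ha he, ← quadTerm_swap _ _ _ _ (a * q)]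
  have hp := quad_params hd ha he (q := q)
  rw [mul_comm (a * q)] at hp
  rw [← sum_div, sum_quadTerm_eq_zero_of_mul_odd_pow_eq_one m hp.1 hp.2 _ hN
    fun k hk => by
      rw [quadDen_swap]
      exact quadDen_ne_zero_of_termDen_ne_zero hd ha he (hD k hk), zero_div]
  rw [div_mul_eq_mul_div, div_eq_one_iff_eq ha, h]
  ring

theorem termDen_ne_zero {F : Type*} [CommRing F] [IsDomain F] {d k : ℕ} {q a e : F} (hd : 0 < d)
    (hq : 1 - q ≠ 0) (hQ : ∀ j < k, 1 - q ^ (d * (j + 1)) ≠ 0)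
    (he : ∀ i, 1 - e * q ^ i ≠ 0) (he' : ∀ i, 0 < i → e - q ^ i ≠ 0)
    (ha : ∀ j, 1 - a * q ^ (2 * d * (j + 1)) ≠ 0) (ha' : ∀ j, a - q ^ (2 * d * (j + 1)) ≠ 0)
    (hq' : ∀ j < k, 1 - q ^ (d + 2 + 2 * d * j) ≠ 0) :
    termDen d q a e k ≠ 0 := by
  simp only [termDen, qPoch, qPochHom, mul_ne_zero_iff, prod_ne_zero_iff, mem_range]
  refine ⟨⟨hq, ⟨fun j hj => ?_, fun j _ => ?_⟩, fun j _ => ?_⟩,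
    ⟨fun j _ => ?_, fun j _ => ?_⟩, fun j hj => ?_⟩
  · convert hQ j hj using 2
    ring
  · convert he (d * j) using 3
    ring
  · convert he' (1 + d + d * j) (by omega) using 2
    ring
  · convert ha j using 2
    ring
  · convert ha' j using 2
    ring
  · convert hq' j hj using 2
    ring

/-! ### Congruences modulo products of primes -/

theorem dvd_sum_of_forall_field {s : Finset ℕ} {N D : ℕ → R3} {p : R3} (hp : Prime p)
    (hD : ∀ k ∈ s, ¬ p ∣ D k)
    (h : ∀ (L : Type) [Field L] (φ : R3 →+* L), (∀ x, φ x = 0 ↔ p ∣ x) →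
      ∑ k ∈ s, φ (N k) / φ (D k) = 0) :
    p ∣ ∑ k ∈ s, N k * ∏ j ∈ s.erase k, D j := by
  have hprime : (Ideal.span {p}).IsPrime := (Ideal.span_singleton_prime hp.ne_zero).2 hp
  let φ : R3 →+* FractionRing (R3 ⧸ Ideal.span {p}) :=
    (algebraMap (R3 ⧸ Ideal.span {p}) _).comp (Ideal.Quotient.mk _)
  have hφ : ∀ x, φ x = 0 ↔ p ∣ x := fun x => by
    simp only [φ, RingHom.comp_apply]
    rw [map_eq_zero_iff _ (IsFractionRing.injective _ _), Ideal.Quotient.eq_zero_iff_mem,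
      Ideal.mem_span_singleton]
  have hs := h _ φ hφ
  rw [← hφ]
  have hD' : ∀ k ∈ s, φ (D k) ≠ 0 := fun k hk => by
    rw [Ne, hφ]
    exact hD k hk
  rw [map_sum, ← mul_zero (∏ j ∈ s, φ (D j)), ← hs, mul_sum]
  refine sum_congr rfl fun k hk => ?_
  rw [map_mul, map_prod, ← mul_prod_erase s _ hk]
  have := hD' k hk
  field_simp

theorem congrMod3_of_primes {s : Finset ℕ} {N D : ℕ → R3} {p₁ p₂ p₃ : R3} (h₁ : Prime p₁)
    (h₂ : Prime p₂) (h₃ : Prime p₃) (h₁₂ : ¬ p₁ ∣ p₂) (h₁₃ : ¬ p₁ ∣ p₃) (h₂₃ : ¬ p₂ ∣ p₃)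
    (hD : ∀ k ∈ s, ¬ p₁ ∣ D k ∧ ¬ p₂ ∣ D k ∧ ¬ p₃ ∣ D k)
    (hN : p₁ ∣ ∑ k ∈ s, N k * ∏ j ∈ s.erase k, D j)
    (hN₂ : p₂ ∣ ∑ k ∈ s, N k * ∏ j ∈ s.erase k, D j)
    (hN₃ : p₃ ∣ ∑ k ∈ s, N k * ∏ j ∈ s.erase k, D j) :
    CongrMod3 (∑ k ∈ s, algebraMap R3 K3 (N k) / algebraMap R3 K3 (D k)) 0 (p₁ * p₂ * p₃) := by
  have hdvd : p₁ * p₂ * p₃ ∣ ∑ k ∈ s, N k * ∏ j ∈ s.erase k, D j :=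
    IsRelPrime.mul_dvd
      (IsRelPrime.mul_left (h₁.irreducible.isRelPrime_iff_not_dvd.2 h₁₃)
        (h₂.irreducible.isRelPrime_iff_not_dvd.2 h₂₃))
      (IsRelPrime.mul_dvd (h₁.irreducible.isRelPrime_iff_not_dvd.2 h₁₂) hN hN₂) hN₃
  obtain ⟨f, hf⟩ := hdvd
  have hD0 : ∀ k ∈ s, D k ≠ 0 := fun k hk h0 => (hD k hk).1 (h0 ▸ dvd_zero p₁)
  refine ⟨f, ∏ k ∈ s, D k, prod_ne_zero_iff.2 hD0, fun p hp hpD hpM => ?_, ?_⟩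
  · obtain ⟨k, hk, hpk⟩ := (hp.dvd_finsetProd_iff _).1 hpD
    have key : ∀ r : R3, Prime r → ¬ r ∣ D k → ¬ p ∣ r := fun r hr hrD hpr =>
      hrD (((hp.irreducible.dvd_symm hr.irreducible) hpr).trans hpk)
    rcases hp.dvd_or_dvd hpM with h | h
    · rcases hp.dvd_or_dvd h with h | h
      · exact key _ h₁ (hD k hk).1 h
      · exact key _ h₂ (hD k hk).2.1 h
    · exact key _ h₃ (hD k hk).2.2 h
  · rw [← map_mul, ← hf, sub_zero, sum_mul, map_sum]
    refine sum_congr rfl fun k hk => ?_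
    have hk0 : algebraMap R3 K3 (D k) ≠ 0 :=
      (map_ne_zero_iff _ (IsFractionRing.injective R3 K3)).2 (hD0 k hk)
    rw [← mul_prod_erase s _ hk, map_mul, map_mul]
    field_simp

theorem not_dvd_of_map {R S : Type*} [CommRing R] [CommRing S] (ψ : R →+* S) {p x : R}
    (hp : ψ p = 0) (hx : ψ x ≠ 0) : ¬ p ∣ x := fun h =>
  hx (zero_dvd_iff.1 (hp ▸ map_dvd ψ h))

/-! ### The moduli -/

theorem prime_Phi3 {n : ℕ} (hn : 0 < n) : Prime (Phi3 n) := by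
  let E : R3 ≃ₐ[ℚ] MvPolynomial (Fin 2) (Polynomial ℚ) :=
    (MvPolynomial.renameEquiv ℚ (finSuccEquiv 2)).trans (MvPolynomial.optionEquivRight ℚ (Fin 2))
  have hX : E (MvPolynomial.X 0) = MvPolynomial.C Polynomial.X := by
    simp [E]
  have hE : E (Phi3 n) = MvPolynomial.C (Polynomial.cyclotomic n ℚ) := by
    rw [Phi3, ← Polynomial.aeval_algHom_apply, hX]
    have := Polynomial.aeval_algHom_apply
      (IsScalarTower.toAlgHom ℚ (Polynomial ℚ) (MvPolynomial (Fin 2) (Polynomial ℚ)))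
      Polynomial.X (Polynomial.cyclotomic n ℚ)
    simpa [Polynomial.aeval_X_left_apply, MvPolynomial.algebraMap_eq] using this
  rw [← MulEquiv.prime_iff E.toMulEquiv]
  change Prime (E (Phi3 n))
  rw [hE, MvPolynomial.prime_C_iff]
  exact (Polynomial.cyclotomic.irreducible_rat hn).prime

theorem prime_one_sub_mul_pow (n : ℕ) :
    Prime (1 - MvPolynomial.X 1 * MvPolynomial.X 0 ^ n : R3) := by
  have hv : (1 : Fin 3) ∉ (-MvPolynomial.X 0 ^ n : R3).vars := by
    rw [MvPolynomial.vars_neg]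
    intro h
    simpa using MvPolynomial.vars_pow _ _ h
  have h := MvPolynomial.irreducible_mul_X_add (-MvPolynomial.X 0 ^ n : R3) 1 1
    (neg_ne_zero.2 (pow_ne_zero _ (MvPolynomial.X_ne_zero 0))) hv (by simp)
    isRelPrime_one_right
  convert h.prime using 1
  ring

theorem prime_sub_pow (n : ℕ) : Prime (MvPolynomial.X 1 - MvPolynomial.X 0 ^ n : R3) := by
  have hv : (1 : Fin 3) ∉ (-MvPolynomial.X 0 ^ n : R3).vars := by
    rw [MvPolynomial.vars_neg]
    intro h
    simpa using MvPolynomial.vars_pow _ _ h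
  have h := MvPolynomial.irreducible_mul_X_add (1 : R3) (-MvPolynomial.X 0 ^ n) 1
    one_ne_zero (by simp) hv isRelPrime_one_left
  convert h.prime using 1
  ring

theorem termDen_ne_zero_of_two {d n k : ℕ} {a : ℚ} (hd : 0 < d) (hn : Odd n)
    (ha : a = 2 ^ n ∨ a * 2 ^ n = 1) : termDen d (2 : ℚ) a 3 k ≠ 0 := by
  have hpow (i : ℕ) (hi : 0 < i) : (1 : ℚ) - 2 ^ i ≠ 0 :=
    (sub_neg.2 (one_lt_pow₀ one_lt_two hi.ne')).ne
  have hodd (j : ℕ) : (2 : ℚ) ^ n ≠ 2 ^ (2 * d * (j + 1)) := fun h => by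
    have h' : n = 2 * d * (j + 1) := Nat.pow_right_injective le_rfl (by exact_mod_cast h)
    rw [h', mul_assoc] at hn
    exact Nat.not_odd_iff_even.2 (even_two_mul _) hn
  have hpos (j : ℕ) : 0 < 2 * d * (j + 1) := by positivity
  refine termDen_ne_zero hd (by norm_num) (fun j _ => hpow _ (by positivity)) (fun i => ?_)
    (fun i hi => ?_) (fun j => ?_) (fun j => ?_) (fun j _ => hpow _ (by positivity))
  · have : (1 : ℚ) ≤ 2 ^ i := one_le_pow₀ one_le_two
    linarith
  · obtain ⟨i, rfl⟩ : ∃ i', i = i' + 1 := ⟨i - 1, by omega⟩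
    intro h
    have h' : 3 = 2 ^ (i + 1) := by exact_mod_cast sub_eq_zero.1 h
    rw [pow_succ] at h'
    omega
  · rcases ha with rfl | ha
    · rw [← pow_add]
      exact hpow _ (by have := hpos j; omega)
    · intro h
      refine hodd j ?_
      linear_combination 2 ^ n * h + 2 ^ (2 * d * (j + 1)) * ha
  · rcases ha with rfl | ha
    · exact sub_ne_zero.2 (hodd j)
    · intro h
      rw [sub_eq_zero.1 h, ← pow_add] at ha
      exact hpow (2 * d * (j + 1) + n) (by have := hpos j; omega) (by rw [ha, sub_self])

theorem termDen_ne_zero_of_isPrimitiveRoot {d n k : ℕ} {ζ : ℂ} (hd : 0 < d)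
    (hζ : IsPrimitiveRoot ζ n) (hn : 1 < n) (h₁ : ∀ j < k, ¬ n ∣ d * (j + 1))
    (h₂ : ∀ j < k, ¬ n ∣ d + 2 + 2 * d * j) : termDen d ζ 2 2 k ≠ 0 := by
  have hnorm (i : ℕ) : ‖ζ ^ i‖ = 1 := by
    rw [norm_pow, hζ.norm'_eq_one (by omega), one_pow]
  have hl (i : ℕ) : 1 - 2 * ζ ^ i ≠ 0 := fun h => by
    have := congrArg norm (sub_eq_zero.1 h)
    rw [norm_mul, hnorm] at this
    norm_num at this
  have hr (i : ℕ) : 2 - ζ ^ i ≠ 0 := fun h => by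
    have := congrArg norm (sub_eq_zero.1 h)
    rw [hnorm] at this
    norm_num at this
  have hone (i : ℕ) (hi : ¬ n ∣ i) : 1 - ζ ^ i ≠ 0 := fun h =>
    hi (hζ.dvd_of_pow_eq_one i (sub_eq_zero.1 h).symm)
  exact termDen_ne_zero hd (sub_ne_zero.2 (hζ.ne_one hn).symm) (fun j hj => hone _ (h₁ j hj)) hl
    (fun i _ => hr i) (fun j => hl _) (fun j => hr _) fun j hj => hone _ (h₂ j hj)

theorem not_dvd_mul_succ {d n N j : ℕ} (hd : 2 ≤ d)
    (hN : 2 * d * N + 1 = (d + 1) * n) (hj : j < N) : ¬ n ∣ d * (j + 1) := by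
  intro h
  have hcop : n.Coprime d := by
    have h1 : (2 * d * N + 1).Coprime d := by
      rw [show 2 * d * N + 1 = 1 + 2 * N * d by ring, Nat.coprime_add_mul_right_left]
      exact Nat.coprime_one_left d
    rw [hN] at h1
    exact h1.coprime_mul_left
  have h1 := Nat.le_of_dvd (by omega) (hcop.dvd_of_dvd_mul_left h)
  nlinarith

theorem not_dvd_add_two_add {d m n N j : ℕ} (hd : 2 ≤ d) (hdeven : Even d)
    (hn : n = 2 * d * m + d + 1) (hN : 2 * d * N + 1 = (d + 1) * n) (hj : j < N) :
    ¬ n ∣ d + 2 + 2 * d * j := by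
  rintro ⟨t, ht⟩
  obtain ⟨h, hh⟩ := hdeven
  have hmod : (2 * d : ℤ) ∣ (d + 2 : ℤ) - t := by
    refine ⟨h * t + m * t * (d + 1) - j * (d + 1) + t - h - 1, ?_⟩
    have ht' : (d + 2 + 2 * d * j : ℤ) = n * t := by exact_mod_cast ht
    have hn' : (n : ℤ) = 2 * d * m + d + 1 := by exact_mod_cast hn
    have hh' : (d : ℤ) = 2 * h := by
      rw [hh]
      push_cast
      ring
    rw [hn'] at ht'
    linear_combination ((d : ℤ) + 1) * ht' + (t * d - d) * hh'
  have ht0 : 0 < t := by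
    rcases Nat.eq_zero_or_pos t with rfl | h0
    · simp at ht
    · exact h0
  have htd : t < d + 2 := by
    by_contra! hge
    have h1 : n * (d + 2) ≤ n * t := Nat.mul_le_mul_left n hge
    have h2 : 2 * d * (j + 1) ≤ 2 * d * N := Nat.mul_le_mul_left _ hj
    nlinarith
  have := Int.le_of_dvd (by omega) hmod
  omega

theorem dvd_pow_sub_one_Phi3 (n : ℕ) : Phi3 n ∣ MvPolynomial.X 0 ^ n - 1 := by
  have h := map_dvd (Polynomial.aeval (MvPolynomial.X 0 : R3))
    (Polynomial.cyclotomic.dvd_X_pow_sub_one n ℚ)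
  simpa [Phi3] using h

/-- Evaluation of polynomials in `q`, `a`, `e` at a point. -/
def evalAt {S : Type*} [CommRing S] [Algebra ℚ S] (q a e : S) : R3 →+* S :=
  (MvPolynomial.aeval ![q, a, e]).toRingHom

@[simp]
theorem evalAt_X_zero {S : Type*} [CommRing S] [Algebra ℚ S] (q a e : S) :
    evalAt q a e (MvPolynomial.X 0) = q := by
  simp [evalAt]

@[simp]
theorem evalAt_X_one {S : Type*} [CommRing S] [Algebra ℚ S] (q a e : S) :
    evalAt q a e (MvPolynomial.X 1) = a := by
  simp [evalAt]

@[simp]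
theorem evalAt_X_two {S : Type*} [CommRing S] [Algebra ℚ S] (q a e : S) :
    evalAt q a e (MvPolynomial.X 2) = e := by
  simp [evalAt]

theorem evalAt_Phi3 {n : ℕ} {ζ : ℂ} (hn : 0 < n) (hζ : IsPrimitiveRoot ζ n) (a e : ℂ) :
    evalAt ζ a e (Phi3 n) = 0 := by
  have : evalAt ζ a e (Phi3 n) = Polynomial.aeval ζ (Polynomial.cyclotomic n ℚ) := by
    change MvPolynomial.aeval ![ζ, a, e] (Phi3 n) = _
    rw [Phi3, ← Polynomial.aeval_algHom_apply]
    simp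
  rw [this, Polynomial.aeval_def, ← Polynomial.eval_map, Polynomial.map_cyclotomic]
  exact hζ.isRoot_cyclotomic hn

/-- Theorem 2.1: for even `d ≥ 2` and `n ≡ d+1 (mod 2d)`,
`Σ_{k=0}^{(dn+n-1)/(2d)} [3dk+1] (q,e,q^{1+d}/e;q^{2d})_k (aq,q/a,q^{d-1};q^d)_k /
((q^d,e,q^{1+d}/e;q^d)_k (aq^{2d},q^{2d}/a,q^{d+2};q^{2d})_k) q^{dk}
≡ 0 (mod Φ_n(q)(1-aq^n)(a-q^n))`. -/
theorem stmt8 (d : ℕ) (hd2 : 2 ≤ d) (hdeven : Even d) (n : ℕ) (hn : 0 < n)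
    (hmod : n % (2 * d) = (d + 1) % (2 * d)) :
    CongrMod3
      (∑ k ∈ Finset.range ((d * n + n - 1) / (2 * d) + 1),
        qInt qv (3 * (d : ℤ) * k + 1) *
          (qPoch qv (qv ^ (2 * d)) k * qPoch ev (qv ^ (2 * d)) k *
            qPoch (qv ^ (1 + d) / ev) (qv ^ (2 * d)) k) *
          (qPoch (av * qv) (qv ^ d) k * qPoch (qv / av) (qv ^ d) k *
            qPoch (qv ^ (d - 1)) (qv ^ d) k) /
          (qPoch (qv ^ d) (qv ^ d) k * qPoch ev (qv ^ d) k *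
            qPoch (qv ^ (1 + d) / ev) (qv ^ d) k *
            (qPoch (av * qv ^ (2 * d)) (qv ^ (2 * d)) k * qPoch (qv ^ (2 * d) / av) (qv ^ (2 * d)) k *
              qPoch (qv ^ (d + 2)) (qv ^ (2 * d)) k)) *
          qv ^ (d * k))
      0
      (Phi3 n * (1 - MvPolynomial.X 1 * MvPolynomial.X 0 ^ n) *
        (MvPolynomial.X 1 - MvPolynomial.X 0 ^ n)) := by
  obtain ⟨h, rfl⟩ := hdeven
  obtain ⟨m, rfl⟩ : ∃ m, n = 2 * (h + h) * m + (h + h) + 1 := by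
    refine ⟨n / (2 * (h + h)), ?_⟩
    have h1 := Nat.div_add_mod n (2 * (h + h))
    rw [hmod, Nat.mod_eq_of_lt (by omega)] at h1
    omega
  set d := h + h with hd
  set n := 2 * d * m + d + 1 with hn'
  set N := m * (d + 1) + h + 1 with hN
  have hd0 : 0 < d := by omega
  have hNn : 2 * d * N + 1 = (d + 1) * n := by
    rw [hN, hn', hd]
    ring
  have hNdiv : (d * n + n - 1) / (2 * d) = N := by
    rw [← Nat.succ_mul, Nat.succ_eq_add_one, ← hNn, Nat.add_sub_cancel]
    exact Nat.mul_div_cancel_left N (by omega)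
  have hmN : 2 * m + 1 ≤ N := by
    have : m * 2 ≤ m * (d + 1) := Nat.mul_le_mul_left m (by omega)
    omega
  have hnodd : Odd n := ⟨d * m + h, by rw [hn', hd]; ring⟩
  have hterm (k : ℕ) := termNum_div_termDen d (q := qv) (a := av) (e := ev)
    (by simp [av]) (by simp [ev]) k
  rw [hNdiv, sum_congr rfl fun k _ => (hterm k).symm]
  simp only [qv, av, ev, ← map_termNum, ← map_termDen]
  let ζ : ℂ := Complex.exp (2 * Real.pi * Complex.I / n)
  have hζ : IsPrimitiveRoot ζ n := Complex.isPrimitiveRoot_exp n hn.ne'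
  have hΦ (x : R3) (hx : evalAt ζ 2 2 x ≠ 0) : ¬ Phi3 n ∣ x :=
    not_dvd_of_map _ (evalAt_Phi3 hn hζ 2 2) hx
  have hA (x : R3) (hx : evalAt (2 : ℚ) (2 ^ n)⁻¹ 3 x ≠ 0) :
      ¬ (1 - MvPolynomial.X 1 * MvPolynomial.X 0 ^ n : R3) ∣ x :=
    not_dvd_of_map _ (by simp) hx
  have hB (x : R3) (hx : evalAt (2 : ℚ) (2 ^ n) 3 x ≠ 0) :
      ¬ (MvPolynomial.X 1 - MvPolynomial.X 0 ^ n : R3) ∣ x :=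
    not_dvd_of_map _ (by simp) hx
  have hDΦ (k : ℕ) (hk : k ∈ range (N + 1)) : ¬ Phi3 n ∣
      termDen d (MvPolynomial.X 0) (MvPolynomial.X 1) (MvPolynomial.X 2) k := by
    refine hΦ _ ?_
    rw [mem_range] at hk
    rw [map_termDen, evalAt_X_zero, evalAt_X_one, evalAt_X_two]
    exact termDen_ne_zero_of_isPrimitiveRoot hd0 hζ (by omega)
      (fun j hj => not_dvd_mul_succ hd2 hNn (by omega))
      (fun j hj => not_dvd_add_two_add hd2 ⟨h, hd⟩ hn' hNn (by omega))
  have hDA (k : ℕ) : ¬ (1 - MvPolynomial.X 1 * MvPolynomial.X 0 ^ n : R3) ∣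
      termDen d (MvPolynomial.X 0) (MvPolynomial.X 1) (MvPolynomial.X 2) k := by
    refine hA _ ?_
    rw [map_termDen, evalAt_X_zero, evalAt_X_one, evalAt_X_two]
    exact termDen_ne_zero_of_two hd0 hnodd (Or.inr (by simp))
  have hDB (k : ℕ) : ¬ (MvPolynomial.X 1 - MvPolynomial.X 0 ^ n : R3) ∣
      termDen d (MvPolynomial.X 0) (MvPolynomial.X 1) (MvPolynomial.X 2) k := by
    refine hB _ ?_
    rw [map_termDen, evalAt_X_zero, evalAt_X_one, evalAt_X_two]
    exact termDen_ne_zero_of_two hd0 hnodd (Or.inl rfl)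
  refine congrMod3_of_primes (prime_Phi3 hn) (prime_one_sub_mul_pow n) (prime_sub_pow n)
    (hΦ _ ?_) (hΦ _ ?_) (hA _ ?_) (fun k hk => ⟨hDΦ k hk, hDA k, hDB k⟩)
    (dvd_sum_of_forall_field (prime_Phi3 hn) hDΦ fun L _ φ hφ => ?_)
    (dvd_sum_of_forall_field (prime_one_sub_mul_pow n) (fun k _ => hDA k) fun L _ φ hφ => ?_)
    (dvd_sum_of_forall_field (prime_sub_pow n) (fun k _ => hDB k) fun L _ φ hφ => ?_)
  · simp [hζ.pow_eq_one]
    norm_num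
  · simp [hζ.pow_eq_one]
    norm_num
  · have h1 : (1 : ℚ) < 2 ^ n := one_lt_pow₀ one_lt_two hn.ne'
    have h2 : ((2 : ℚ) ^ n)⁻¹ < 1 := inv_lt_one_of_one_lt₀ h1
    simp only [map_sub, map_pow, evalAt_X_zero, evalAt_X_one]
    linarith
  · simp only [map_termNum, map_termDen]
    refine sum_term_eq_zero_of_pow_eq_one hd0 ((hφ _).not.2 (hΦ _ (by simp)))
      ((hφ _).not.2 (hΦ _ (by simp))) (fun k hk => ?_) ?_
    · rw [← map_termDen, Ne, hφ]
      exact hDΦ k (mem_range.2 (by omega))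
    · have h1 := (hφ _).2 (dvd_pow_sub_one_Phi3 n)
      rw [map_sub, map_pow, map_one, sub_eq_zero] at h1
      rw [hNn, mul_comm, pow_mul, h1, one_pow]
  · simp only [map_termNum, map_termDen]
    refine sum_term_eq_zero_of_mul_pow_eq_one hd0 ((hφ _).not.2 (hA _ (by simp)))
      ((hφ _).not.2 (hA _ (by simp))) (fun k _ => ?_) hmN ?_
    · rw [← map_termDen, Ne, hφ]
      exact hDA k
    · have h1 := (hφ _).2 dvd_rfl
      rw [map_sub, map_mul, map_pow, map_one, sub_eq_zero] at h1
      exact h1.symm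
  · simp only [map_termNum, map_termDen]
    refine sum_term_eq_zero_of_eq_pow hd0 ((hφ _).not.2 (hB _ (by simp)))
      ((hφ _).not.2 (hB _ (by simp))) (fun k _ => ?_) hmN ?_
    · rw [← map_termDen, Ne, hφ]
      exact hDB k
    · have h1 := (hφ _).2 dvd_rfl
      rwa [map_sub, map_pow, sub_eq_zero] at h1

end
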